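/- arXiv:1704.04009 — 5 statements merged into one kernel-verified Lean document; each statement's English description precedes it below -/
import Mathlib

section
/- Let A be a real n×n matrix. Then A is Hurwitz (every eigenvalue of A, viewed as a complex matrix, has strictly negative real part) if and only if there exists an invertible real n×n matrix T such that K = T⁻¹ A T has negative definite Hermitian part, i.e., Kᵀ + K is negative definite. -/
open Matrix

/-- A real square matrix is Hurwitz if every eigenvalue of it, viewed as a
complex matrix, has strictly negative real part. -/
def IsHurwitz {n : ℕ} (A : Matrix (Fin n) (Fin n) ℝ) : Prop :=
  ∀ μ ∈ spectrum ℂ (A.map (Complex.ofReal)), μ.re < 0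

open Filter Topology

section FrobeniusNorm

open scoped Matrix.Norms.Frobenius

variable {m : Type*} [Fintype m] [DecidableEq m]

/-- If all eigenvalues of a complex matrix lie in the open unit disc, some positive power of it has
Frobenius norm less than one. -/
theorem exists_norm_pow_succ_lt_one [Nonempty m] (C : Matrix m m ℂ)
    (hC : ∀ μ ∈ spectrum ℂ C, ‖μ‖ < 1) : ∃ k : ℕ, ‖C ^ (k + 1)‖ < 1 := by
  have : CompleteSpace (Matrix m m ℂ) := FiniteDimensional.complete ℂ _
  have hr : spectralRadius ℂ C < ((1 : NNReal) : ENNReal) :=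
    spectrum.spectralRadius_lt_of_forall_lt C fun z hz ↦ hC z hz
  have hev := (spectrum.pow_nnnorm_pow_one_div_tendsto_nhds_spectralRadius C).eventually
    (gt_mem_nhds hr)
  obtain ⟨N, hN⟩ := eventually_atTop.1 hev
  refine ⟨N, ?_⟩
  have h := hN (N + 1) N.le_succ
  by_contra! hle
  refine absurd h (not_lt.2 ?_)
  have h1 : (1 : ENNReal) ≤ (‖C ^ (N + 1)‖₊ : ENNReal) := by exact_mod_cast hle
  simpa using ENNReal.rpow_le_rpow h1 (show (0 : ℝ) ≤ 1 / ((N + 1 : ℕ) : ℝ) by positivity)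

/-- `1 - MᵀM` is positive definite when `M` is a strict contraction. -/
theorem posDef_one_sub_transpose_mul_self (M : Matrix m m ℝ) (hM : ‖M‖ < 1) :
    (1 - Mᵀ * M).PosDef := by
  refine PosDef.of_dotProduct_mulVec_pos ?_ fun x hx ↦ ?_
  · simp [IsHermitian, conjTranspose_eq_transpose_of_trivial, transpose_mul]
  · have hsq (y : m → ℝ) : ‖WithLp.toLp 2 y‖ ^ 2 = y ⬝ᵥ y := by
      rw [EuclideanSpace.real_norm_sq_eq]
      simp [dotProduct, sq]
    have hle : ‖WithLp.toLp 2 (M *ᵥ x)‖ ≤ ‖M‖ * ‖WithLp.toLp 2 x‖ := by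
      have h := frobenius_norm_mul M (replicateCol Unit x)
      rwa [← replicateCol_mulVec, frobenius_norm_replicateCol, frobenius_norm_replicateCol] at h
    have hpos : 0 < ‖WithLp.toLp 2 x‖ := by simpa using hx
    have hlt : ‖WithLp.toLp 2 (M *ᵥ x)‖ < ‖WithLp.toLp 2 x‖ :=
      hle.trans_lt (mul_lt_of_lt_one_left hpos hM)
    have h2 := pow_lt_pow_left₀ hlt (norm_nonneg _) two_ne_zero
    rw [hsq, hsq] at h2
    rw [star_trivial, sub_mulVec, one_mulVec, dotProduct_sub, ← mulVec_mulVec, dotProduct_mulVec,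
      vecMul_transpose]
    exact sub_pos.2 h2

/-- The discrete-time Lyapunov (Stein) inequality: if all eigenvalues of a real matrix lie in the
open unit disc, then it is a strict contraction for some inner product. -/
theorem exists_posDef_sub_transpose_mul_mul_posDef [Nonempty m] (C : Matrix m m ℝ)
    (hC : ∀ μ ∈ spectrum ℂ (C.map Complex.ofReal), ‖μ‖ < 1) :
    ∃ H : Matrix m m ℝ, H.PosDef ∧ (H - Cᵀ * H * C).PosDef := by
  obtain ⟨k, hk⟩ := exists_norm_pow_succ_lt_one _ hC
  have hmap : C.map Complex.ofReal ^ (k + 1) = (C ^ (k + 1)).map Complex.ofReal :=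
    (map_pow (Complex.ofRealHom.mapMatrix (m := m)) C (k + 1)).symm
  rw [hmap, frobenius_norm_map_eq _ _ fun a ↦ Complex.norm_real a] at hk
  refine ⟨∑ i ∈ Finset.range (k + 1), (C ^ i)ᵀ * C ^ i, ?_, ?_⟩
  · rw [Finset.sum_range_succ']
    refine PosDef.posSemidef_add (posSemidef_sum _ fun i _ ↦ ?_) (by simpa using PosDef.one)
    rw [← conjTranspose_eq_transpose_of_trivial]
    exact posSemidef_conjTranspose_mul_self _
  · convert posDef_one_sub_transpose_mul_self _ hk using 1
    have hstep (i : ℕ) : Cᵀ * ((C ^ i)ᵀ * C ^ i) * C = (C ^ (i + 1))ᵀ * C ^ (i + 1) := by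
      rw [pow_succ, transpose_mul]
      simp only [Matrix.mul_assoc]
    rw [Finset.mul_sum, Finset.sum_mul, ← Finset.sum_sub_distrib]
    simp_rw [hstep]
    rw [Finset.sum_range_sub' (fun i ↦ (C ^ i)ᵀ * C ^ i)]
    simp

end FrobeniusNorm

/-- The map `λ ↦ (1 + λ) / (1 - λ)` takes the open left half-plane to the open unit disc. -/
theorem Complex.norm_lt_one_of_sub_one_div_add_one_re_neg {μ : ℂ}
    (h : ((μ - 1) / (μ + 1)).re < 0) : ‖μ‖ < 1 := by
  have hne : μ + 1 ≠ 0 := by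
    rintro h0
    simp [h0] at h
  have hpos := Complex.normSq_pos.2 hne
  rw [Complex.div_re, ← add_div, div_lt_iff₀ hpos, zero_mul] at h
  have hsq : ‖μ‖ ^ 2 < 1 := by
    rw [Complex.sq_norm, Complex.normSq_apply]
    simp at h
    nlinarith
  exact (sq_lt_one_iff₀ (norm_nonneg _)).1 hsq

/-- The eigenvalues of the Cayley transform `(1 + A)(1 - A)⁻¹` of a matrix with spectrum in the open
left half-plane lie in the open unit disc. -/
theorem norm_lt_one_of_mem_spectrum_cayley {R : Type*} [Ring R] [Algebra ℂ R] {a b μ}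
    (ha : ∀ μ ∈ spectrum ℂ (a : R), μ.re < 0) (hb : IsUnit b) (hab : (1 - a) * b = 1)
    (hμ : μ ∈ spectrum ℂ ((1 + a) * b)) : ‖μ‖ < 1 := by
  have hfac : algebraMap ℂ R μ - (1 + a) * b
      = (algebraMap ℂ R (μ - 1) - algebraMap ℂ R (μ + 1) * a) * b := by
    calc _ = algebraMap ℂ R μ * ((1 - a) * b) - (1 + a) * b := by rw [hab, mul_one]
      _ = _ := by simp only [map_sub, map_add, map_one]; noncomm_ring
  rw [spectrum.mem_iff, hfac] at hμ
  have hns : ¬ IsUnit (algebraMap ℂ R (μ - 1) - algebraMap ℂ R (μ + 1) * a) :=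
    fun h ↦ hμ (h.mul hb)
  have hne : μ + 1 ≠ 0 := by
    intro h0
    have h1 : μ - 1 ≠ 0 := by
      rw [eq_neg_of_add_eq_zero_left h0]
      norm_num
    rw [h0, map_zero, zero_mul, sub_zero] at hns
    exact hns (h1.isUnit.map (algebraMap ℂ R))
  refine Complex.norm_lt_one_of_sub_one_div_add_one_re_neg (ha _ fun hu ↦ hns ?_)
  have h := (hne.isUnit.map (algebraMap ℂ R)).mul hu
  rwa [mul_sub, ← map_mul, mul_div_cancel₀ _ hne] at h

section Lyapunov

variable {m : Type*} [Fintype m] [DecidableEq m]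

/-- The Lyapunov inequality: if all eigenvalues of a real matrix `A` have negative real part, then
`AᵀH + HA` is negative definite for some positive definite `H`. -/
theorem exists_posDef_neg_transpose_mul_add_mul_posDef (A : Matrix m m ℝ)
    (hA : ∀ μ ∈ spectrum ℂ (A.map Complex.ofReal), μ.re < 0) :
    ∃ H : Matrix m m ℝ, H.PosDef ∧ (-(Aᵀ * H + H * A)).PosDef := by
  cases isEmpty_or_nonempty m
  · exact ⟨1, PosDef.one, by
      convert PosDef.one (n := m) (R := ℝ)
      exact Subsingleton.elim _ _⟩
  let φ : Matrix m m ℝ →+* Matrix m m ℂ := Complex.ofRealHom.mapMatrix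
  have hunit : IsUnit (1 - A) := by
    have h1 : IsUnit (φ (1 - A)) := by
      by_contra h
      refine absurd (hA 1 ?_) (by simp)
      rw [spectrum.mem_iff, map_one]
      rwa [map_sub, map_one] at h
    rw [isUnit_iff_isUnit_det] at h1 ⊢
    rw [← RingHom.map_det] at h1
    simpa using h1
  have hdet := (isUnit_iff_isUnit_det _).1 hunit
  have hC : ∀ μ ∈ spectrum ℂ (((1 + A) * (1 - A)⁻¹).map Complex.ofReal), ‖μ‖ < 1 := by
    intro μ hμ
    change μ ∈ spectrum ℂ (φ ((1 + A) * (1 - A)⁻¹)) at hμ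
    rw [map_mul, map_add, map_one] at hμ
    refine norm_lt_one_of_mem_spectrum_cayley hA ?_ ?_ hμ
    · exact ((isUnit_nonsing_inv_iff).2 hunit).map φ
    · have h := congrArg φ (mul_nonsing_inv _ hdet)
      rwa [map_mul, map_sub, map_one] at h
  obtain ⟨H, hH, hHC⟩ := exists_posDef_sub_transpose_mul_mul_posDef _ hC
  refine ⟨H, hH, ?_⟩
  have h := (hHC.conjTranspose_mul_mul_same (mulVec_injective_iff_isUnit.2 hunit)).smul
    (show (0 : ℝ) < 1 / 2 by norm_num)
  convert h using 1
  have hCA : (1 + A) * (1 - A)⁻¹ * (1 - A) = 1 + A := nonsing_inv_mul_cancel_right _ _ hdet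
  generalize (1 + A) * (1 - A)⁻¹ = C at hCA
  have hCA' : (1 - Aᵀ) * Cᵀ = 1 + Aᵀ := by
    simpa [transpose_mul] using congrArg transpose hCA
  have hexp : (1 - A)ᴴ * (H - Cᵀ * H * C) * (1 - A) =
      (1 - Aᵀ) * H * (1 - A) - ((1 - Aᵀ) * Cᵀ) * H * (C * (1 - A)) := by
    rw [conjTranspose_eq_transpose_of_trivial, transpose_sub, transpose_one]
    noncomm_ring
  rw [hexp, hCA, hCA', eq_comm, one_div, inv_smul_eq_iff₀ two_ne_zero, two_smul]
  noncomm_ring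

/-- If `K + Kᵀ` is negative definite, every complex eigenvalue of `K` has negative real part. -/
theorem re_neg_of_mem_spectrum_of_neg_transpose_add_posDef (K : Matrix m m ℝ)
    (hK : (-(Kᵀ + K)).PosDef) {μ : ℂ} (hμ : μ ∈ spectrum ℂ (K.map Complex.ofReal)) :
    μ.re < 0 := by
  rw [← spectrum_toLin', ← Module.End.hasEigenvalue_iff_mem_spectrum] at hμ
  obtain ⟨z, hz⟩ := hμ.exists_hasEigenvector
  have hzμ : K.map Complex.ofReal *ᵥ z = μ • z := by simpa using hz.apply_eq_smul
  set x : m → ℝ := fun i ↦ (z i).re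
  set y : m → ℝ := fun i ↦ (z i).im
  have hKx : K *ᵥ x = μ.re • x - μ.im • y := by
    ext i
    simpa [mulVec, dotProduct] using congrArg Complex.re (congrFun hzμ i)
  have hKy : K *ᵥ y = μ.re • y + μ.im • x := by
    ext i
    simpa [mulVec, dotProduct] using congrArg Complex.im (congrFun hzμ i)
  have hform (v : m → ℝ) : v ⬝ᵥ (-(Kᵀ + K) *ᵥ v) = -2 * (v ⬝ᵥ K *ᵥ v) := by
    rw [neg_mulVec, add_mulVec, dotProduct_neg, dotProduct_add, mulVec_transpose,
      dotProduct_comm v (v ᵥ* K), ← dotProduct_mulVec]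
    ring
  have hnonneg (v : m → ℝ) : v ⬝ᵥ K *ᵥ v ≤ 0 := by
    have h := hK.posSemidef.dotProduct_mulVec_nonneg v
    rw [star_trivial, hform] at h
    linarith
  have hneg {v : m → ℝ} (hv : v ≠ 0) : v ⬝ᵥ K *ᵥ v < 0 := by
    have h := hK.dotProduct_mulVec_pos hv
    rw [star_trivial, hform] at h
    linarith
  have hsum : x ⬝ᵥ K *ᵥ x + y ⬝ᵥ K *ᵥ y = μ.re * (x ⬝ᵥ x + y ⬝ᵥ y) := by
    rw [hKx, hKy, dotProduct_sub, dotProduct_add]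
    simp only [dotProduct_smul, smul_eq_mul, dotProduct_comm y x]
    ring
  have hlt : x ⬝ᵥ K *ᵥ x + y ⬝ᵥ K *ᵥ y < 0 := by
    by_cases hx0 : x = 0
    · refine add_neg_of_nonpos_of_neg (hnonneg x) (hneg fun hy0 ↦ hz.2 ?_)
      ext i
      exact Complex.ext (congrFun hx0 i) (congrFun hy0 i)
    · exact add_neg_of_neg_of_nonpos (hneg hx0) (hnonneg y)
  rw [hsum] at hlt
  have hxx : 0 ≤ x ⬝ᵥ x := by simpa using dotProduct_star_self_nonneg x
  have hyy : 0 ≤ y ⬝ᵥ y := by simpa using dotProduct_star_self_nonneg y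
  exact neg_of_mul_neg_left hlt (add_nonneg hxx hyy)

end Lyapunov

theorem hurwitz_iff_similar_to_negative_hermitian_part
    {n : ℕ} (A : Matrix (Fin n) (Fin n) ℝ) :
    IsHurwitz A ↔
      ∃ T : Matrix (Fin n) (Fin n) ℝ, IsUnit T ∧
        (-(((T⁻¹ * A * T)ᵀ) + (T⁻¹ * A * T))).PosDef := by
  constructor
  · intro hA
    obtain ⟨H, hH, hHA⟩ := exists_posDef_neg_transpose_mul_add_mul_posDef A hA
    obtain ⟨S, hS, rfl⟩ : ∃ S : Matrix (Fin n) (Fin n) ℝ, IsUnit S ∧ H = Sᵀ * S := by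
      open scoped MatrixOrder in
      obtain ⟨S, hS⟩ := CStarAlgebra.nonneg_iff_eq_star_mul_self.mp hH.posSemidef.nonneg
      rw [star_eq_conjTranspose, conjTranspose_eq_transpose_of_trivial] at hS
      refine ⟨S, ?_, hS⟩
      have h := hH.isUnit
      rw [hS, isUnit_iff_isUnit_det, det_mul] at h
      exact (isUnit_iff_isUnit_det _).2 (isUnit_of_mul_isUnit_right h)
    have hdet := (isUnit_iff_isUnit_det _).1 hS
    have hS' : IsUnit S⁻¹ := isUnit_nonsing_inv_iff.2 hS
    refine ⟨S⁻¹, hS', ?_⟩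
    convert hHA.conjTranspose_mul_mul_same (mulVec_injective_iff_isUnit.2 hS') using 1
    have h1 : S * S⁻¹ = 1 := mul_nonsing_inv _ hdet
    have h2 : S⁻¹ᵀ * Sᵀ = 1 := by rw [← transpose_mul, h1, transpose_one]
    rw [nonsing_inv_nonsing_inv _ hdet, conjTranspose_eq_transpose_of_trivial]
    calc -((S * A * S⁻¹)ᵀ + S * A * S⁻¹)
        = -(S⁻¹ᵀ * Aᵀ * Sᵀ * (S * S⁻¹) + (S⁻¹ᵀ * Sᵀ) * S * A * S⁻¹) := by
          simp [h1, h2, transpose_mul, Matrix.mul_assoc]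
      _ = _ := by noncomm_ring
  · rintro ⟨T, hT, hK⟩ μ hμ
    refine re_neg_of_mem_spectrum_of_neg_transpose_add_posDef _ hK ?_
    let φ : Matrix (Fin n) (Fin n) ℝ →+* Matrix (Fin n) (Fin n) ℂ := Complex.ofRealHom.mapMatrix
    obtain ⟨u, rfl⟩ := hT
    let v : (Matrix (Fin n) (Fin n) ℂ)ˣ := Units.map φ.toMonoidHom u
    have hconj : (((u : Matrix (Fin n) (Fin n) ℝ)⁻¹ * A * u).map Complex.ofReal)
        = (v⁻¹).val * φ A * v.val := by
      change φ _ = _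
      rw [← coe_units_inv, map_mul, map_mul]
      rfl
    rw [hconj, spectrum.units_conjugate']
    exact hμ
end

section
/- Let A be a real n×n matrix and M a symmetric positive definite real n×n matrix satisfying the non-strict Lyapunov inequality Aᵀ M + M A ⪯ 0 (negative semidefinite). Let Φ be a real n×k matrix of full column rank, set N = Φᵀ M Φ (which is symmetric positive definite), and let Ψ = M Φ N⁻¹. Then the reduced matrix Ã = Ψᵀ A Φ satisfies Ãᵀ N + N Ã ⪯ 0; in particular, every eigenvalue of Ã has nonpositive real part. -/
open Matrix

namespace Matrix

theorem mulVec_injective_of_rank_eq_card {m n K : Type*} [Fintype m] [Fintype n] [Field K]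
    (A : Matrix m n K) (hA : A.rank = Fintype.card n) : Function.Injective A.mulVec := by
  rw [mulVec_injective_iff, linearIndependent_iff_card_eq_finrank_span,
    Set.finrank, ← rank_eq_finrank_span_cols, hA]

theorem IsSymm.dotProduct_mulVec_comm {n R : Type*} [Fintype n] [CommSemiring R]
    {N : Matrix n n R} (hN : N.IsSymm) (x y : n → R) : x ⬝ᵥ (N *ᵥ y) = y ⬝ᵥ (N *ᵥ x) := by
  rw [dotProduct_mulVec, ← mulVec_transpose, hN.eq, dotProduct_comm]

/-- Non-strict Lyapunov stability: a matrix that is dissipative in the inner product given by a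
positive definite matrix has its complex spectrum in the closed left half-plane. -/
theorem PosDef.re_nonpos_of_mem_spectrum {n : Type*} [Fintype n] [DecidableEq n]
    {N B : Matrix n n ℝ} (hN : N.PosDef) (hB : (-(Bᵀ * N + N * B)).PosSemidef)
    {μ : ℂ} (hμ : μ ∈ spectrum ℂ (B.map Complex.ofReal)) : μ.re ≤ 0 := by
  have hNsymm : N.IsSymm := isHermitian_iff_isSymm.1 hN.isHermitian
  have hform (x : n → ℝ) : x ⬝ᵥ (N *ᵥ (B *ᵥ x)) ≤ 0 := by
    have h := hB.dotProduct_mulVec_nonneg x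
    have hsymm : x ⬝ᵥ (Bᵀ *ᵥ (N *ᵥ x)) = x ⬝ᵥ (N *ᵥ (B *ᵥ x)) := by
      rw [dotProduct_mulVec, vecMul_transpose, hNsymm.dotProduct_mulVec_comm]
    simp only [star_trivial, neg_mulVec, add_mulVec, dotProduct_neg, dotProduct_add,
      ← mulVec_mulVec, hsymm] at h
    linarith
  rw [← spectrum_toLin', ← Module.End.hasEigenvalue_iff_mem_spectrum] at hμ
  obtain ⟨v, hv⟩ := hμ.exists_hasEigenvector
  have hBv : B.map Complex.ofReal *ᵥ v = μ • v := by simpa using hv.apply_eq_smul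
  set x : n → ℝ := fun i => (v i).re with hx
  set y : n → ℝ := fun i => (v i).im with hy
  have hBx : B *ᵥ x = μ.re • x - μ.im • y := by
    ext i
    simpa [mulVec, dotProduct, hx, hy] using congrArg Complex.re (congrFun hBv i)
  have hBy : B *ᵥ y = μ.re • y + μ.im • x := by
    ext i
    simpa [mulVec, dotProduct, hx, hy] using congrArg Complex.im (congrFun hBv i)
  have hxy := hNsymm.dotProduct_mulVec_comm x y
  have hpos : 0 < x ⬝ᵥ (N *ᵥ x) + y ⬝ᵥ (N *ᵥ y) := by
    have hx0 := hN.posSemidef.dotProduct_mulVec_nonneg x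
    have hy0 := hN.posSemidef.dotProduct_mulVec_nonneg y
    rw [star_trivial] at hx0 hy0
    by_cases h : x = 0
    · have hyne : y ≠ 0 := fun h' => hv.2 <| by
        ext i
        exact Complex.ext (congrFun h i) (congrFun h' i)
      have := hN.dotProduct_mulVec_pos hyne
      rw [star_trivial] at this
      linarith
    · have := hN.dotProduct_mulVec_pos h
      rw [star_trivial] at this
      linarith
  have h₁ := hform x
  have h₂ := hform y
  rw [hBx, mulVec_sub, mulVec_smul, mulVec_smul, dotProduct_sub, dotProduct_smul,
    dotProduct_smul, smul_eq_mul, smul_eq_mul, hxy] at h₁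
  rw [hBy, mulVec_add, mulVec_smul, mulVec_smul, dotProduct_add, dotProduct_smul,
    dotProduct_smul, smul_eq_mul, smul_eq_mul] at h₂
  by_contra! hre
  nlinarith [mul_pos hre hpos]

end Matrix

theorem innerProduct_projection_preserves_nonstrict_lyapunov
    {n k : ℕ} (A M : Matrix (Fin n) (Fin n) ℝ) (Φ : Matrix (Fin n) (Fin k) ℝ)
    (hM : M.PosDef)
    (hLyap : (-(Aᵀ * M + M * A)).PosSemidef)
    (hΦ : Φ.rank = k)
    (N : Matrix (Fin k) (Fin k) ℝ) (hN : N = Φᵀ * M * Φ)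
    (Ψ : Matrix (Fin n) (Fin k) ℝ) (hΨ : Ψ = M * Φ * N⁻¹)
    (Ared : Matrix (Fin k) (Fin k) ℝ) (hAred : Ared = Ψᵀ * A * Φ) :
    (-(Aredᵀ * N + N * Ared)).PosSemidef ∧
      ∀ μ ∈ spectrum ℂ (Ared.map (Complex.ofReal)), μ.re ≤ 0 := by
  have hNpos : N.PosDef := by
    have h := hM.conjTranspose_mul_mul_same
      (Φ.mulVec_injective_of_rank_eq_card (by simpa using hΦ))
    rwa [conjTranspose_eq_transpose_of_trivial, ← hN] at h
  have hMt : Mᵀ = M := (isHermitian_iff_isSymm.1 hM.isHermitian).eq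
  have hNt : Nᵀ = N := (isHermitian_iff_isSymm.1 hNpos.isHermitian).eq
  have hNA : N * Ared = Φᵀ * (M * A) * Φ := by
    rw [hAred, hΨ, transpose_mul, transpose_mul, transpose_nonsing_inv, hNt, hMt]
    simp only [Matrix.mul_assoc]
    exact mul_nonsing_inv_cancel_left _ _ ((isUnit_iff_isUnit_det N).1 hNpos.isUnit)
  have hAN : Aredᵀ * N = Φᵀ * (Aᵀ * M) * Φ := by
    have h := congrArg transpose hNA
    simpa only [transpose_mul, transpose_transpose, hNt, hMt, Matrix.mul_assoc] using h
  have hred : (-(Aredᵀ * N + N * Ared)).PosSemidef := by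
    have h := hLyap.conjTranspose_mul_mul_same Φ
    rwa [conjTranspose_eq_transpose_of_trivial, Matrix.mul_neg, Matrix.neg_mul, Matrix.mul_add,
      Matrix.add_mul, ← hNA, ← hAN] at h
  exact ⟨hred, fun _ hμ => hNpos.re_nonpos_of_mem_spectrum hred hμ⟩
end

section
/- Let A be a real 2n×2n matrix that is diagonalizable over ℂ and whose eigenvalues (over ℂ) are all nonzero and purely imaginary. Then A is a generalized Hamiltonian matrix: there exists an invertible skew-symmetric real 2n×2n matrix J_Ω such that Aᵀ J_Ω + J_Ω A = 0. -/
open Matrix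

/-- A complex square matrix is diagonalizable if it is conjugate to a diagonal
matrix by an invertible matrix. -/
def IsDiagonalizable {m : Type*} [Fintype m] [DecidableEq m]
    (A : Matrix m m ℂ) : Prop :=
  ∃ P D : Matrix m m ℂ, IsUnit P ∧ D.IsDiag ∧ A = P * D * P⁻¹

open scoped ComplexOrder in
/-- The entrywise real part of a positive definite complex matrix is positive definite. -/
lemma Matrix.PosDef.map_re {m : Type*} [Fintype m] {H : Matrix m m ℂ} (hH : H.PosDef) :
    (H.map Complex.re).PosDef := by
  refine .of_dotProduct_mulVec_pos ?_ fun x hx ↦ ?_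
  · ext i j
    simpa using congrArg Complex.re (hH.isHermitian.apply i j)
  · have hx' : (fun i ↦ (x i : ℂ)) ≠ 0 := fun h ↦ hx <| funext fun i ↦ by
      simpa using congrFun h i
    have hpos := (Complex.pos_iff.mp (hH.dotProduct_mulVec_pos hx')).1
    simpa [dotProduct, mulVec] using hpos

open scoped ComplexOrder in
/-- A diagonalizable complex matrix with purely imaginary spectrum is skew-adjoint with respect to
some positive definite Hermitian form. -/
lemma IsDiagonalizable.exists_posDef_conjTranspose_mul_add_mul_eq_zero
    {m : Type*} [Fintype m] [DecidableEq m] {A : Matrix m m ℂ} (hA : IsDiagonalizable A)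
    (hre : ∀ μ ∈ spectrum ℂ A, μ.re = 0) :
    ∃ H : Matrix m m ℂ, H.PosDef ∧ Aᴴ * H + H * A = 0 := by
  obtain ⟨P, D, hP, hD, rfl⟩ := hA
  have hdet : IsUnit P.det := (isUnit_iff_isUnit_det P).mp hP
  rw [← hD.diagonal_diag] at hre ⊢
  generalize D.diag = d at hre ⊢
  have hd : (diagonal d)ᴴ + diagonal d = 0 := by
    have hspec : spectrum ℂ (P * diagonal d * P⁻¹) = Set.range d := by
      rw [← spectrum_diagonal d, ← spectrum.units_conjugate (a := diagonal d) (u := hP.unit),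
        coe_units_inv, hP.unit_spec]
    rw [diagonal_conjTranspose, diagonal_add, diagonal_eq_zero]
    funext i
    have hi := hre (d i) (hspec ▸ Set.mem_range_self i)
    apply Complex.ext <;> simp [hi]
  refine ⟨(P⁻¹)ᴴ * P⁻¹, ?_, ?_⟩
  · exact PosDef.conjTranspose_mul_self _
      (mulVec_injective_of_isUnit (isUnit_nonsing_inv_iff.mpr hP))
  · have hBA : P⁻¹ * (P * diagonal d * P⁻¹) = diagonal d * P⁻¹ := by
      rw [mul_assoc P, nonsing_inv_mul_cancel_left _ _ hdet]
    calc _ = (P⁻¹ * (P * diagonal d * P⁻¹))ᴴ * P⁻¹ +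
          (P⁻¹)ᴴ * (P⁻¹ * (P * diagonal d * P⁻¹)) := by
          rw [conjTranspose_mul P⁻¹, mul_assoc _ (P⁻¹)ᴴ, ← mul_assoc (P⁻¹)ᴴ,
            mul_assoc (P⁻¹)ᴴ P⁻¹]
      _ = (P⁻¹)ᴴ * ((diagonal d)ᴴ + diagonal d) * P⁻¹ := by
          rw [hBA, conjTranspose_mul, mul_add, add_mul, mul_assoc (P⁻¹)ᴴ (diagonal d)]
      _ = 0 := by rw [hd, mul_zero, zero_mul]

theorem diagonalizable_pure_imaginary_is_generalized_hamiltonian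
    {n : ℕ} (A : Matrix (Fin n ⊕ Fin n) (Fin n ⊕ Fin n) ℝ)
    (hdiag : IsDiagonalizable (A.map Complex.ofReal))
    (heig : ∀ μ ∈ spectrum ℂ (A.map Complex.ofReal), μ ≠ 0 ∧ μ.re = 0) :
    ∃ JΩ : Matrix (Fin n ⊕ Fin n) (Fin n ⊕ Fin n) ℝ,
      JΩᵀ = -JΩ ∧ IsUnit JΩ ∧ Aᵀ * JΩ + JΩ * A = 0 := by
  obtain ⟨H, hH, hAH⟩ := hdiag.exists_posDef_conjTranspose_mul_add_mul_eq_zero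
    fun μ hμ ↦ (heig μ hμ).2
  have hQ := hH.map_re
  set Q := H.map Complex.re
  have hAQ : Aᵀ * Q + Q * A = 0 := by
    ext i j
    simpa [Q, mul_apply] using congrArg Complex.re (congrFun₂ hAH i j)
  have hQt : Qᵀ = Q := by simpa using hQ.isHermitian.eq
  have hA : IsUnit A := by
    have h0 : IsUnit (A.map Complex.ofReal) :=
      spectrum.isUnit_of_zero_notMem ℂ fun h ↦ (heig 0 h).1 rfl
    rw [isUnit_iff_isUnit_det] at h0 ⊢
    have hdet : (A.map Complex.ofReal).det = (A.det : ℂ) :=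
      (Complex.ofRealHom.map_det A).symm
    simpa [hdet] using h0
  refine ⟨Q * A, ?_, hQ.isUnit.mul hA, ?_⟩
  · rw [transpose_mul, hQt]
    exact eq_neg_of_add_eq_zero_left hAQ
  · rw [← mul_assoc, ← add_mul, hAQ, zero_mul]
end

section
/- Let J_Ω be an invertible skew-symmetric real 2n×2n matrix, L an invertible symmetric real 2n×2n matrix, and A = −J_Ω⁻¹ L. Let Φ be a real 2n×2k matrix such that J_Π := Φᵀ J_Ω Φ is invertible, and set Ψ = J_Ω Φ J_Π⁻¹. Then the reduced matrix Ã = Ψᵀ A Φ equals −J_Π⁻¹ (Φᵀ L Φ), where J_Π is invertible and skew-symmetric and Φᵀ L Φ is symmetric; in particular, Ã satisfies Ãᵀ J_Π + J_Π Ã = 0, i.e., the reduced system is again a generalized Hamiltonian system. -/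
open Matrix

/-- The inverse of a skew-symmetric matrix is skew-symmetric. -/
theorem Matrix.transpose_inv_of_transpose_eq_neg {m R : Type*} [Fintype m] [DecidableEq m]
    [CommRing R] {J : Matrix m m R} (hJ : Jᵀ = -J) (hu : IsUnit J) : J⁻¹ᵀ = -J⁻¹ := by
  have hdet := (isUnit_iff_isUnit_det J).mp hu
  rw [transpose_nonsing_inv, hJ]
  exact inv_eq_left_inv (by rw [neg_mul_neg, nonsing_inv_mul _ hdet])

theorem symplectic_projection_preserves_hamiltonian
    {n k : ℕ}
    (JΩ L A : Matrix (Fin n ⊕ Fin n) (Fin n ⊕ Fin n) ℝ)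
    (hJΩskew : JΩᵀ = -JΩ) (hJΩunit : IsUnit JΩ)
    (hLsymm : L.IsSymm) (hLunit : IsUnit L)
    (hA : A = -(JΩ⁻¹ * L))
    (Φ : Matrix (Fin n ⊕ Fin n) (Fin k ⊕ Fin k) ℝ)
    (JPi : Matrix (Fin k ⊕ Fin k) (Fin k ⊕ Fin k) ℝ) (hJPi : JPi = Φᵀ * JΩ * Φ)
    (hJPiUnit : IsUnit JPi)
    (Ψ : Matrix (Fin n ⊕ Fin n) (Fin k ⊕ Fin k) ℝ) (hΨ : Ψ = JΩ * Φ * JPi⁻¹) :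
    Ψᵀ * A * Φ = -(JPi⁻¹ * (Φᵀ * L * Φ)) ∧
      JPiᵀ = -JPi ∧ (Φᵀ * L * Φ).IsSymm ∧
      (Ψᵀ * A * Φ)ᵀ * JPi + JPi * (Ψᵀ * A * Φ) = 0 := by
  have hΩ := (isUnit_iff_isUnit_det JΩ).mp hJΩunit
  have hPi := (isUnit_iff_isUnit_det JPi).mp hJPiUnit
  have hskew : JPiᵀ = -JPi := by
    simp [hJPi, transpose_mul, hJΩskew, Matrix.mul_assoc]
  have hinv : JPi⁻¹ᵀ = -JPi⁻¹ := transpose_inv_of_transpose_eq_neg hskew hJPiUnit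
  have hsymm : (Φᵀ * L * Φ)ᵀ = Φᵀ * L * Φ := by
    simp [transpose_mul, hLsymm.eq, Matrix.mul_assoc]
  have hred : Ψᵀ * A * Φ = -(JPi⁻¹ * (Φᵀ * L * Φ)) := by
    rw [hΨ, hA, transpose_mul, transpose_mul, hinv, hJΩskew]
    simp [Matrix.mul_assoc, mul_nonsing_inv_cancel_left _ _ hΩ]
  refine ⟨hred, hskew, hsymm, ?_⟩
  rw [hred, transpose_neg, transpose_mul, hsymm, hinv, Matrix.mul_neg, neg_neg, Matrix.mul_neg,
    nonsing_inv_mul_cancel_right _ _ hPi, mul_nonsing_inv_cancel_left _ _ hPi, add_neg_cancel]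
end

section
/- Let T be an invertible real 2n×2n matrix with Tᵀ J_Ω T = J_{2n} (where J_Ω is invertible and skew-symmetric), let Φ₀ be a real 2n×2k matrix with Φ₀ᵀ J_{2n} Φ₀ = J_{2k}, and set Φ = T Φ₀, M = (Tᵀ)⁻¹ T⁻¹ (which is symmetric positive definite), Ψᵀ = J_{2k}⁻¹ Φᵀ J_Ω, and Ψ₀ᵀ = J_{2k}⁻¹ Φ₀ᵀ J_{2n}. Then for any snapshots x₁,…,x_N ∈ ℝ^{2n} with yᵢ = T⁻¹ xᵢ, the weighted symplectic projection error equals the Euclidean one: Σᵢ ‖xᵢ − Φ Ψᵀ xᵢ‖²_M = Σᵢ ‖yᵢ − Φ₀ Ψ₀ᵀ yᵢ‖², where ‖v‖²_M = vᵀ M v. -/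
open Matrix Finset

/-- The Poisson matrix `J_{2m} = [[0, I_m], [−I_m, 0]]`, with `ℝ^{2m}` indexed by
`Fin m ⊕ Fin m`. -/
def PoissonMatrix (m : ℕ) : Matrix (Fin m ⊕ Fin m) (Fin m ⊕ Fin m) ℝ :=
  Matrix.fromBlocks 0 1 (-1) 0

namespace Matrix

/-- The quadratic form of `(Aᵀ)⁻¹ * A⁻¹` is the squared Euclidean length after applying `A⁻¹`. -/
theorem dotProduct_transpose_inv_mul_inv_mulVec {ι R : Type*} [Fintype ι] [DecidableEq ι]
    [CommRing R] (A : Matrix ι ι R) (v : ι → R) :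
    v ⬝ᵥ ((Aᵀ)⁻¹ * A⁻¹) *ᵥ v = (A⁻¹ *ᵥ v) ⬝ᵥ (A⁻¹ *ᵥ v) := by
  rw [← transpose_nonsing_inv, ← mulVec_mulVec, dotProduct_mulVec, vecMul_transpose]

/-- Pulling back a form `J` along an invertible `T` intertwines the symplectic projections. -/
theorem inv_mul_symplectic_projection {ι κ R : Type*} [Fintype ι] [DecidableEq ι] [Fintype κ]
    [CommRing R] {T : Matrix ι ι R} (hT : IsUnit T) (J : Matrix ι ι R) (B : Matrix ι κ R)
    (K : Matrix κ κ R) :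
    T⁻¹ * (T * B * (K * (T * B)ᵀ * J)) = B * (K * Bᵀ * (Tᵀ * J * T)) * T⁻¹ := by
  have hdet := (isUnit_iff_isUnit_det T).mp hT
  simp only [transpose_mul, Matrix.mul_assoc, nonsing_inv_mul_cancel_left _ _ hdet,
    mul_nonsing_inv _ hdet, Matrix.mul_one]

end Matrix

theorem symplectic_projection_error_invariance
    {n k N : ℕ}
    (JΩ : Matrix (Fin n ⊕ Fin n) (Fin n ⊕ Fin n) ℝ)
    (hJΩskew : JΩᵀ = -JΩ) (hJΩunit : IsUnit JΩ)
    (T : Matrix (Fin n ⊕ Fin n) (Fin n ⊕ Fin n) ℝ)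
    (hT : IsUnit T) (hTJ : Tᵀ * JΩ * T = PoissonMatrix n)
    (Φ₀ : Matrix (Fin n ⊕ Fin n) (Fin k ⊕ Fin k) ℝ)
    (hΦ₀ : Φ₀ᵀ * PoissonMatrix n * Φ₀ = PoissonMatrix k)
    (Φ : Matrix (Fin n ⊕ Fin n) (Fin k ⊕ Fin k) ℝ) (hΦ : Φ = T * Φ₀)
    (M : Matrix (Fin n ⊕ Fin n) (Fin n ⊕ Fin n) ℝ) (hM : M = (Tᵀ)⁻¹ * T⁻¹)
    (PsiT : Matrix (Fin k ⊕ Fin k) (Fin n ⊕ Fin n) ℝ)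
    (hPsiT : PsiT = (PoissonMatrix k)⁻¹ * Φᵀ * JΩ)
    (Psi0T : Matrix (Fin k ⊕ Fin k) (Fin n ⊕ Fin n) ℝ)
    (hPsi0T : Psi0T = (PoissonMatrix k)⁻¹ * Φ₀ᵀ * PoissonMatrix n)
    (x : Fin N → (Fin n ⊕ Fin n) → ℝ) (y : Fin N → (Fin n ⊕ Fin n) → ℝ)
    (hy : ∀ i, y i = T⁻¹.mulVec (x i)) :
    ∑ i, (x i - (Φ * PsiT).mulVec (x i)) ⬝ᵥ
          M.mulVec (x i - (Φ * PsiT).mulVec (x i)) =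
      ∑ i, (y i - (Φ₀ * Psi0T).mulVec (y i)) ⬝ᵥ
          (y i - (Φ₀ * Psi0T).mulVec (y i)) := by
  subst hΦ hM hPsiT hPsi0T
  refine Finset.sum_congr rfl fun i _ => ?_
  rw [Matrix.dotProduct_transpose_inv_mul_inv_mulVec, Matrix.mulVec_sub, Matrix.mulVec_mulVec,
    Matrix.inv_mul_symplectic_projection hT, hTJ, ← Matrix.mulVec_mulVec, ← hy]
end
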